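/- Fix integers N ≥ 1 and n ≥ 1. Let (λ_i)_{i≥1} be a nondecreasing sequence of positive reals, q_c ∈ ℝ, and (a_i), (b_i), (c_i) real sequences with S_a := ∑_{i>N} a_i² < ∞, S_b := ∑_{i>N} b_i² < ∞ and M₁ := ∑_{i>N} c_i²/λ_i < ∞. Let A be a real n×n matrix, B ∈ ℝⁿ a column vector, C ∈ ℝ^{1×n} a row vector, μ ∈ ℝ, and set A_e = A + μBC. Define A_N = diag(−λ₁+q_c, …, −λ_N+q_c), B_{a,N} = (a₁,…,a_N)ᵀ, B_{b,N} = (b₁,…,b_N)ᵀ, C_N = (c₁,…,c_N), F = [[A_N + B_{b,N}CBC_N, B_{a,N}C + B_{b,N}CA_e], [BC_N, A_e]], G = [B_{b,N}CB; B], and H = blockdiag( S_b · C_NᵀBᵀCᵀCBC_N , S_a · CᵀC + S_b · A_eᵀCᵀCA_e ). Assume there exist a symmetric positive definite (N+n)×(N+n) matrix P, α > 2, β > 0 and η > 0 such that the symmetric matrices Θ_{1,η} = [[FᵀP + PF + 2ηP + αH, PG], [GᵀP, α S_b (CB)² − β]] and Θ_{2,η} = [[−λ_{N+1} + q_c + η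 + βM₁/2, √(2λ_{N+1})], [√(2λ_{N+1}), −α]] are negative semidefinite. Let x : [0,∞) → ℝⁿ and w_i : [0,∞) → ℝ (i ≥ 1) be continuous functions, differentiable on (0,∞), such that for every t ≥ 0 the series ∑_{j≥1} c_j w_j(t) converges absolutely, ∑_{i>N} λ_i w_i(t)² < ∞ and ∑_{i>N} λ_i² w_i(t)² < ∞, satisfying for all t > 0 and all i ≥ 1: w_i'(t) = (−λ_i + q_c) w_i(t) + a_i C x(t) + b_i C ( A_e x(t) + B ∑_{j≥1} c_j w_j(t) ) and x'(t) = A_e x(t) + B ∑_{j≥1} c_j w_j(t). Assume further that the function S(t) = ∑_{i>N} λ_i w_i(t)² is continuous on [0,∞) and differentiable on (0,∞) with S'(t) = ∑_{i>N} 2 λ_i w_i(t) w_i'(t), the series converging absolutely. Then, with X(t) = (w₁(t),…,w_N(t), x(t)ᵀ)ᵀ ∈ ℝ^{N+n} and V(t) = X(t)ᵀ P X(t) + S(t), one has V(t) ≤ e^{−2ηt} V(0) for all t ≥ 0. -/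

import Mathlib

open Real Set Matrix

/-- Cauchy–Schwarz for series, in the form where the squares of the summands factor. -/
lemma sq_le_mul_of_hasSum {r f g : ℕ → ℝ} {z M T : ℝ} (hr : HasSum r z) (hf : HasSum f M)
    (hg : HasSum g T) (hf0 : ∀ k, 0 ≤ f k) (hg0 : ∀ k, 0 ≤ g k)
    (h : ∀ k, r k ^ 2 = f k * g k) : z ^ 2 ≤ M * T :=
  le_of_tendsto_of_tendsto' (hr.pow 2) (Filter.Tendsto.mul hf hg) fun s =>
    Finset.sum_sq_le_sum_mul_sum_of_sq_le_mul s (fun k _ => hf0 k) (fun k _ => hg0 k)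
      fun k _ => (h k).le

lemma hasDerivAt_dotProduct_mulVec {ι : Type*} [Fintype ι] (P : Matrix ι ι ℝ)
    {X : ℝ → ι → ℝ} {X' : ι → ℝ} {t : ℝ} (h : ∀ i, HasDerivAt (fun s => X s i) (X' i) t) :
    HasDerivAt (fun s => X s ⬝ᵥ P *ᵥ X s) (X' ⬝ᵥ P *ᵥ X t + X t ⬝ᵥ P *ᵥ X') t := by
  have h1 (i : ι) : HasDerivAt (fun s => (P *ᵥ X s) i) ((P *ᵥ X') i) t :=
    HasDerivAt.fun_sum fun j _ => (h j).const_mul (P i j)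
  have h2 := HasDerivAt.fun_sum (u := Finset.univ) fun i _ => (h i).fun_mul (h1 i)
  simpa only [dotProduct, Finset.sum_add_distrib] using h2

lemma continuousOn_dotProduct_mulVec {ι : Type*} [Fintype ι] (P : Matrix ι ι ℝ)
    {X : ℝ → ι → ℝ} {s : Set ℝ} (h : ∀ i, ContinuousOn (fun t => X t i) s) :
    ContinuousOn (fun t => X t ⬝ᵥ P *ᵥ X t) s :=
  continuousOn_finsetSum _ fun i _ => (h i).mul <|
    continuousOn_finsetSum _ fun j _ => continuousOn_const.mul (h j)

/-- Gronwall's inequality for a linear differential inequality. -/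
lemma le_exp_mul_of_deriv_le {V V' : ℝ → ℝ} {κ : ℝ} (hc : ContinuousOn V (Ici 0))
    (hd : ∀ t, 0 < t → HasDerivAt V (V' t) t) (h : ∀ t, 0 < t → V' t ≤ κ * V t)
    {t : ℝ} (ht : 0 ≤ t) : V t ≤ Real.exp (κ * t) * V 0 := by
  have hderiv (s : ℝ) (hs : 0 < s) : HasDerivAt (fun s => Real.exp (-κ * s) * V s)
      (Real.exp (-κ * s) * (V' s - κ * V s)) s := by
    have h1 := (((hasDerivAt_id s).const_mul (-κ)).exp).mul (hd s hs)
    refine h1.congr_deriv ?_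
    simp only [id, mul_one]
    ring
  have hanti : AntitoneOn (fun s => Real.exp (-κ * s) * V s) (Ici 0) := by
    refine antitoneOn_of_deriv_nonpos (convex_Ici 0) ?_ ?_ ?_
    · exact (by fun_prop : Continuous fun s : ℝ => Real.exp (-κ * s)).continuousOn.mul hc
    · intro s hs
      rw [interior_Ici] at hs
      exact (hderiv s hs).differentiableAt.differentiableWithinAt
    · intro s hs
      rw [interior_Ici] at hs
      rw [(hderiv s hs).deriv]
      exact mul_nonpos_of_nonneg_of_nonpos (Real.exp_pos _).le (sub_nonpos.2 (h s hs))
  have h0 := hanti (mem_Ici.2 le_rfl) (mem_Ici.2 ht) ht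
  simp only [mul_zero, Real.exp_zero, one_mul] at h0
  calc V t = Real.exp (κ * t) * (Real.exp (-κ * t) * V t) := by
        rw [← mul_assoc, ← Real.exp_add]; simp
    _ ≤ Real.exp (κ * t) * V 0 := by gcongr

lemma dotProduct_transpose_mul_mulVec {ι κ ν : Type*} [Fintype ι] [Fintype κ] [Fintype ν]
    (M : Matrix ι κ ℝ) (P : Matrix ι ν ℝ) (y : κ → ℝ) (v : ν → ℝ) :
    y ⬝ᵥ (Mᵀ * P) *ᵥ v = (M *ᵥ y) ⬝ᵥ P *ᵥ v := by
  rw [← mulVec_mulVec, dotProduct_mulVec, vecMul_transpose]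

lemma dotProduct_transpose_mul_self_mulVec {ι : Type*} [Fintype ι] (M : Matrix (Fin 1) ι ℝ)
    (v : ι → ℝ) : v ⬝ᵥ (Mᵀ * M) *ᵥ v = (M *ᵥ v) 0 ^ 2 := by
  rw [dotProduct_transpose_mul_mulVec]
  simp [dotProduct, sq]

lemma dotProduct_fromBlocks_mulVec {ι κ : Type*} [Fintype ι] [Fintype κ]
    (A : Matrix ι ι ℝ) (B : Matrix ι κ ℝ) (C : Matrix κ ι ℝ) (D : Matrix κ κ ℝ)
    (v : ι → ℝ) (w : κ → ℝ) :
    Sum.elim v w ⬝ᵥ fromBlocks A B C D *ᵥ Sum.elim v w =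
      v ⬝ᵥ A *ᵥ v + v ⬝ᵥ B *ᵥ w + w ⬝ᵥ C *ᵥ v + w ⬝ᵥ D *ᵥ w := by
  rw [fromBlocks_mulVec, sumElim_dotProduct_sumElim]
  simp only [Sum.elim_comp_inl, Sum.elim_comp_inr, dotProduct_add]
  ring

/-- Expansion of the quadratic form of a bordered Lyapunov matrix along `F v + z G`. -/
lemma dotProduct_lyapunov_mulVec {ι : Type*} [Fintype ι] (F P H : Matrix ι ι ℝ)
    (G : Matrix ι (Fin 1) ℝ) (α η δ z : ℝ) (v : ι → ℝ) :
    Sum.elim v (fun _ => z) ⬝ᵥ fromBlocks (Fᵀ * P + P * F + (2 * η) • P + α • H) (P * G) (Gᵀ * P)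
        (Matrix.of fun (_ : Fin 1) (_ : Fin 1) => δ) *ᵥ Sum.elim v (fun _ => z) =
      (F *ᵥ v + G *ᵥ fun _ => z) ⬝ᵥ P *ᵥ v + v ⬝ᵥ P *ᵥ (F *ᵥ v + G *ᵥ fun _ => z)
        + 2 * η * (v ⬝ᵥ P *ᵥ v) + α * (v ⬝ᵥ H *ᵥ v) + δ * z ^ 2 := by
  have hδ : (fun _ : Fin 1 => z) ⬝ᵥ (Matrix.of fun (_ : Fin 1) (_ : Fin 1) => δ) *ᵥ
      (fun _ : Fin 1 => z) = δ * z ^ 2 := by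
    simp [dotProduct, mulVec]
    ring
  rw [dotProduct_fromBlocks_mulVec, dotProduct_transpose_mul_mulVec, hδ]
  simp only [add_mulVec, dotProduct_add, add_dotProduct, mulVec_add, smul_mulVec,
    dotProduct_smul, smul_eq_mul, dotProduct_transpose_mul_mulVec, mulVec_mulVec]
  ring

/-- Schur-complement consequence of a `2 × 2` negative semidefinite matrix. -/
lemma add_div_nonpos_of_neg_posSemidef {e s α : ℝ} (hα : 0 < α)
    (h : (-!![e, s; s, -α]).PosSemidef) : e + s ^ 2 / α ≤ 0 := by
  have h1 := h.dotProduct_mulVec_nonneg ![α, s]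
  simp [dotProduct, mulVec, Fin.sum_univ_two] at h1
  have h2 : α * (e * α + s ^ 2) ≤ 0 := by nlinarith
  have h3 : e * α + s ^ 2 ≤ 0 := by
    by_contra! hlt
    exact absurd h2 (not_le.2 (mul_pos hα hlt))
  rw [show e + s ^ 2 / α = (e * α + s ^ 2) / α by field_simp]
  exact div_nonpos_of_nonpos_of_nonneg h3 hα.le

/-- Young's inequality applied to the four coupling terms of one residual mode. -/
lemma residual_mode_le {l l₀ y qc a b p q r s α κ : ℝ} (hα : 2 < α) (hl : 0 < l)
    (hl₀ : l₀ ≤ l) (hκ : -l₀ + qc + κ / 2 + 2 * l₀ / α ≤ 0) :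
    2 * l * y * ((-l + qc) * y + a * p + b * (q + r + s)) ≤
      -κ * (l * y ^ 2) + α * p ^ 2 * a ^ 2 + α * (q ^ 2 + r ^ 2 + s ^ 2) * b ^ 2 := by
  have hα0 : 0 < α := by linarith
  have young (d : ℝ) : 2 * (l * y) * d ≤ (l * y) ^ 2 / α + α * d ^ 2 := by
    have : 0 ≤ (l * y - α * d) ^ 2 / α := by positivity
    have h2 : (l * y - α * d) ^ 2 / α = (l * y) ^ 2 / α + α * d ^ 2 - 2 * (l * y) * d := by
      field_simp
      ring
    linarith
  have hmono : -l + qc + κ / 2 + 2 * l / α ≤ 0 := by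
    have h1 : 2 / α ≤ 1 := (div_le_one hα0).2 hα.le
    have h2 : 0 ≤ (l - l₀) * (1 - 2 / α) := mul_nonneg (by linarith) (by linarith)
    have h3 : 2 * l / α = l * (2 / α) := by ring
    have h4 : 2 * l₀ / α = l₀ * (2 / α) := by ring
    nlinarith
  have hneg : 2 * (l * y ^ 2) * (-l + qc + κ / 2 + 2 * l / α) ≤ 0 :=
    mul_nonpos_of_nonneg_of_nonpos (by positivity) hmono
  have hexp : 2 * (l * y ^ 2) * (-l + qc + κ / 2 + 2 * l / α) =
      2 * (l * y ^ 2) * (-l + qc) + κ * (l * y ^ 2) + 4 * ((l * y) ^ 2 / α) := by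
    field_simp
    ring
  linarith [young (a * p), young (b * q), young (b * r), young (b * s)]

/-- Core Lyapunov decay estimate of Theorem 1 at the level of
the spectrally reduced system: under the LMI conditions `Θ_{1,η} ⪯ 0` and
`Θ_{2,η} ⪯ 0` (Dirichlet measurement, constant `M₁ = M_{1,φ}`), the Lyapunov
functional `V(t) = X(t)ᵀPX(t) + ∑_{i>N} λ_i w_i(t)²` along the trajectories of
the reduced dynamics satisfies `V(t) ≤ e^{−2ηt} V(0)` for all `t ≥ 0`. -/
theorem lyapunov_decay_dirichlet_measurement
    (N n : ℕ) (hN : 1 ≤ N) (hn : 1 ≤ n)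
    (lam : ℕ → ℝ)
    (hlampos : ∀ i : ℕ, 1 ≤ i → 0 < lam i)
    (hlammono : ∀ i j : ℕ, 1 ≤ i → i ≤ j → lam i ≤ lam j)
    (qc : ℝ) (a b c : ℕ → ℝ) (Sa Sb M₁ : ℝ)
    (hSa : HasSum (fun k : ℕ => (a (k + N + 1)) ^ 2) Sa)
    (hSb : HasSum (fun k : ℕ => (b (k + N + 1)) ^ 2) Sb)
    (hM₁ : HasSum (fun k : ℕ => (c (k + N + 1)) ^ 2 / lam (k + N + 1)) M₁)
    (A : Matrix (Fin n) (Fin n) ℝ) (B : Matrix (Fin n) (Fin 1) ℝ)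
    (C : Matrix (Fin 1) (Fin n) ℝ) (μ : ℝ)
    (Ae : Matrix (Fin n) (Fin n) ℝ) (hAe : Ae = A + μ • (B * C))
    (AN : Matrix (Fin N) (Fin N) ℝ)
    (hAN : AN = Matrix.diagonal (fun i : Fin N => -lam ((i : ℕ) + 1) + qc))
    (BaN : Matrix (Fin N) (Fin 1) ℝ)
    (hBaN : BaN = Matrix.of fun (i : Fin N) (_ : Fin 1) => a ((i : ℕ) + 1))
    (BbN : Matrix (Fin N) (Fin 1) ℝ)
    (hBbN : BbN = Matrix.of fun (i : Fin N) (_ : Fin 1) => b ((i : ℕ) + 1))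
    (CN : Matrix (Fin 1) (Fin N) ℝ)
    (hCN : CN = Matrix.of fun (_ : Fin 1) (j : Fin N) => c ((j : ℕ) + 1))
    (F : Matrix (Fin N ⊕ Fin n) (Fin N ⊕ Fin n) ℝ)
    (hF : F = Matrix.fromBlocks (AN + BbN * C * B * CN) (BaN * C + BbN * C * Ae)
      (B * CN) Ae)
    (G : Matrix (Fin N ⊕ Fin n) (Fin 1) ℝ)
    (hG : G = Matrix.of fun (i : Fin N ⊕ Fin n) (j : Fin 1) =>
      Sum.elim (fun k => (BbN * C * B) k j) (fun k => B k j) i)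
    (H : Matrix (Fin N ⊕ Fin n) (Fin N ⊕ Fin n) ℝ)
    (hH : H = Matrix.fromBlocks (Sb • (CNᵀ * Bᵀ * Cᵀ * C * B * CN)) 0 0
      (Sa • (Cᵀ * C) + Sb • (Aeᵀ * Cᵀ * C * Ae)))
    (P : Matrix (Fin N ⊕ Fin n) (Fin N ⊕ Fin n) ℝ)
    (hPsymm : P.IsSymm) (hPpos : P.PosDef)
    (α β η : ℝ) (hα : 2 < α) (hβ : 0 < β) (hη : 0 < η)
    (Θ₁ : Matrix ((Fin N ⊕ Fin n) ⊕ Fin 1) ((Fin N ⊕ Fin n) ⊕ Fin 1) ℝ)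
    (hΘ₁def : Θ₁ = Matrix.fromBlocks
      (Fᵀ * P + P * F + (2 * η) • P + α • H) (P * G) (Gᵀ * P)
      (Matrix.of fun (_ : Fin 1) (_ : Fin 1) =>
        α * Sb * ((C * B) 0 0) ^ 2 - β))
    (hΘ₁ : (-Θ₁).PosSemidef)
    (Θ₂ : Matrix (Fin 2) (Fin 2) ℝ)
    (hΘ₂def : Θ₂ = !![-lam (N + 1) + qc + η + β * M₁ / 2,
        Real.sqrt (2 * lam (N + 1));
      Real.sqrt (2 * lam (N + 1)), -α])
    (hΘ₂ : (-Θ₂).PosSemidef)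
    (x : ℝ → Fin n → ℝ) (w : ℕ → ℝ → ℝ)
    (hxcont : ∀ i : Fin n, ContinuousOn (fun t => x t i) (Ici (0:ℝ)))
    (hwcont : ∀ i : ℕ, 1 ≤ i → ContinuousOn (w i) (Ici (0:ℝ)))
    (hRabs : ∀ t : ℝ, 0 ≤ t → Summable (fun j : ℕ => |c (j + 1) * w (j + 1) t|))
    (hsum1 : ∀ t : ℝ, 0 ≤ t →
      Summable (fun k : ℕ => lam (k + N + 1) * (w (k + N + 1) t) ^ 2))
    (hsum2 : ∀ t : ℝ, 0 ≤ t →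
      Summable (fun k : ℕ => (lam (k + N + 1)) ^ 2 * (w (k + N + 1) t) ^ 2))
    (R : ℝ → ℝ) (hR : ∀ t : ℝ, R t = ∑' j : ℕ, c (j + 1) * w (j + 1) t)
    (u : ℝ → Fin n → ℝ)
    (hu : ∀ t : ℝ, u t = Ae.mulVec (x t) + R t • (fun k : Fin n => B k 0))
    (hw : ∀ t : ℝ, 0 < t → ∀ i : ℕ, 1 ≤ i →
      HasDerivAt (w i) ((-lam i + qc) * w i t + a i * (C.mulVec (x t) 0)
        + b i * (C.mulVec (u t) 0)) t)
    (hx : ∀ t : ℝ, 0 < t → ∀ i : Fin n, HasDerivAt (fun s => x s i) (u t i) t)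
    (S : ℝ → ℝ)
    (hS : ∀ t : ℝ, 0 ≤ t →
      HasSum (fun k : ℕ => lam (k + N + 1) * (w (k + N + 1) t) ^ 2) (S t))
    (hScont : ContinuousOn S (Ici (0:ℝ)))
    (hSabs : ∀ t : ℝ, 0 < t → Summable (fun k : ℕ =>
      |2 * lam (k + N + 1) * w (k + N + 1) t *
        ((-lam (k + N + 1) + qc) * w (k + N + 1) t
          + a (k + N + 1) * (C.mulVec (x t) 0)
          + b (k + N + 1) * (C.mulVec (u t) 0))|))
    (hSderiv : ∀ t : ℝ, 0 < t → HasDerivAt S (∑' k : ℕ,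
      2 * lam (k + N + 1) * w (k + N + 1) t *
        ((-lam (k + N + 1) + qc) * w (k + N + 1) t
          + a (k + N + 1) * (C.mulVec (x t) 0)
          + b (k + N + 1) * (C.mulVec (u t) 0))) t)
    (X : ℝ → (Fin N ⊕ Fin n) → ℝ)
    (hX : ∀ t : ℝ, X t = Sum.elim (fun i : Fin N => w ((i : ℕ) + 1) t) (x t))
    (V : ℝ → ℝ)
    (hV : ∀ t : ℝ, V t = X t ⬝ᵥ P.mulVec (X t) + S t) :
    ∀ t : ℝ, 0 ≤ t → V t ≤ Real.exp (-2 * η * t) * V 0 := by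
  have hα0 : 0 < α := by linarith
  subst hAN hBaN hBbN hCN hG hH
  set CN : Matrix (Fin 1) (Fin N) ℝ :=
    Matrix.of fun (_ : Fin 1) (j : Fin N) => c ((j : ℕ) + 1)
  have hSchur : -lam (N + 1) + qc + (2 * η + β * M₁) / 2 + 2 * lam (N + 1) / α ≤ 0 := by
    rw [hΘ₂def] at hΘ₂
    have h := add_div_nonpos_of_neg_posSemidef hα0 hΘ₂
    rw [Real.sq_sqrt (by linarith [hlampos (N + 1) (by omega)])] at h
    linarith
  have hXcont (i : Fin N ⊕ Fin n) : ContinuousOn (fun t => X t i) (Ici (0 : ℝ)) := by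
    simp only [hX]
    rcases i with i | i
    · exact hwcont _ (by omega)
    · exact hxcont i
  intro t ht
  set V' : ℝ → ℝ := fun t =>
    Sum.elim (fun i : Fin N => (-lam (i + 1) + qc) * w (i + 1) t + a (i + 1) * (C *ᵥ x t) 0
      + b (i + 1) * (C *ᵥ u t) 0) (u t) ⬝ᵥ P *ᵥ X t
    + X t ⬝ᵥ P *ᵥ Sum.elim (fun i : Fin N => (-lam (i + 1) + qc) * w (i + 1) t
      + a (i + 1) * (C *ᵥ x t) 0 + b (i + 1) * (C *ᵥ u t) 0) (u t)
    + ∑' k : ℕ, 2 * lam (k + N + 1) * w (k + N + 1) t *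
        ((-lam (k + N + 1) + qc) * w (k + N + 1) t
          + a (k + N + 1) * (C.mulVec (x t) 0)
          + b (k + N + 1) * (C.mulVec (u t) 0)) with hV'
  refine le_exp_mul_of_deriv_le (V' := V') (κ := -2 * η) ?_ ?_ ?_ ht
  · rw [funext hV]
    exact (continuousOn_dotProduct_mulVec P hXcont).add hScont
  · intro t ht
    rw [funext hV]
    refine (hasDerivAt_dotProduct_mulVec P fun i => ?_).add (hSderiv t ht)
    simp only [hX]
    rcases i with i | i
    · exact hw t ht _ (by omega)
    · exact hx t ht i
  intro t ht
  set y : Fin N → ℝ := fun i => w (i + 1) t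
  have hXt : X t = Sum.elim y (x t) := hX t
  set z : ℝ := ∑' k : ℕ, c (k + N + 1) * w (k + N + 1) t
  have hsum : Summable fun j : ℕ => c (j + 1) * w (j + 1) t := (hRabs t ht.le).of_abs
  have hzsum : HasSum (fun k : ℕ => c (k + N + 1) * w (k + N + 1) t) z :=
    ((summable_nat_add_iff N).2 hsum).hasSum
  have hRt : R t = (CN *ᵥ y) 0 + z := by
    rw [hR, ← hsum.sum_add_tsum_nat_add N, Finset.sum_range]
    rfl
  have hCu : (C *ᵥ u t) 0 = (C *ᵥ Ae *ᵥ x t) 0 + (C * B) 0 0 * (CN *ᵥ y) 0 + (C * B) 0 0 * z := by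
    have hCB : (C *ᵥ fun k => B k 0) 0 = (C * B) 0 0 := rfl
    rw [hu, mulVec_add, mulVec_smul, Pi.add_apply, Pi.smul_apply, hCB, hRt, smul_eq_mul]
    ring
  have hcol {m : Type} (M : Matrix m (Fin 1) ℝ) (v : Fin 1 → ℝ) (i : m) :
      (M *ᵥ v) i = M i 0 * v 0 := by
    simp [mulVec, dotProduct]
  have hX' : Sum.elim (fun i : Fin N => (-lam (i + 1) + qc) * w (i + 1) t
      + a (i + 1) * (C *ᵥ x t) 0 + b (i + 1) * (C *ᵥ u t) 0) (u t) =
      F *ᵥ X t + (Matrix.of fun (i : Fin N ⊕ Fin n) (j : Fin 1) => Sum.elim (fun k =>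
        ((Matrix.of fun (i : Fin N) (_ : Fin 1) => b ((i : ℕ) + 1)) * C * B) k j)
        (fun k => B k j) i) *ᵥ fun _ => z := by
    rw [hF, hXt, fromBlocks_mulVec]
    funext i
    rw [Pi.add_apply, hcol]
    rcases i with i | i
    · simp only [Sum.elim_inl, Sum.elim_comp_inl, Sum.elim_comp_inr, Pi.add_apply, add_mulVec,
        mulVec_diagonal, Matrix.of_apply, Matrix.mul_assoc, ← mulVec_mulVec, hcol, hCu]
      have hbCB : ((Matrix.of fun (i : Fin N) (_ : Fin 1) => b ((i : ℕ) + 1)) * (C * B)) i 0 =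
          b (i + 1) * (C * B) 0 0 := by
        simp [Matrix.mul_apply]
      have hCBy : (C *ᵥ B *ᵥ CN *ᵥ y) 0 = (C * B) 0 0 * (CN *ᵥ y) 0 := by
        rw [mulVec_mulVec, hcol]
      rw [hbCB, hCBy]
      ring
    · simp only [Sum.elim_inr, Sum.elim_comp_inl, Sum.elim_comp_inr, Pi.add_apply,
        Matrix.of_apply, ← mulVec_mulVec, hcol, hu, hRt, Pi.smul_apply, smul_eq_mul]
      ring
  have hz2 : z ^ 2 ≤ M₁ * S t := by
    have hl (k : ℕ) : 0 < lam (k + N + 1) := hlampos _ (by omega)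
    refine sq_le_mul_of_hasSum hzsum hM₁ (hS t ht.le) (fun k => ?_) (fun k => ?_) fun k => ?_
    · exact div_nonneg (sq_nonneg _) (hl k).le
    · exact mul_nonneg (hl k).le (sq_nonneg _)
    · have := (hl k).ne'
      field_simp
  have hS' : (∑' k : ℕ, 2 * lam (k + N + 1) * w (k + N + 1) t *
        ((-lam (k + N + 1) + qc) * w (k + N + 1) t
          + a (k + N + 1) * (C.mulVec (x t) 0)
          + b (k + N + 1) * (C.mulVec (u t) 0))) ≤
      -(2 * η + β * M₁) * S t + α * (C *ᵥ x t) 0 ^ 2 * Sa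
        + α * ((C *ᵥ Ae *ᵥ x t) 0 ^ 2 + ((C * B) 0 0 * (CN *ᵥ y) 0) ^ 2
          + ((C * B) 0 0 * z) ^ 2) * Sb := by
    refine hasSum_le (fun k => ?_) (hSabs t ht).of_abs.hasSum
      ((((hS t ht.le).mul_left _).add (hSa.mul_left _)).add (hSb.mul_left _))
    rw [hCu]
    exact residual_mode_le hα (hlampos _ (by omega))
      (hlammono _ _ (by omega) (by omega)) hSchur
  have hH : X t ⬝ᵥ (fromBlocks (Sb • (CNᵀ * Bᵀ * Cᵀ * C * B * CN)) 0 0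
      (Sa • (Cᵀ * C) + Sb • (Aeᵀ * Cᵀ * C * Ae))) *ᵥ X t =
      Sb * ((C * B) 0 0 * (CN *ᵥ y) 0) ^ 2 + Sa * (C *ᵥ x t) 0 ^ 2
        + Sb * (C *ᵥ Ae *ᵥ x t) 0 ^ 2 := by
    have h1 : CNᵀ * Bᵀ * Cᵀ * C * B * CN = (C * B * CN)ᵀ * (C * B * CN) := by
      simp only [transpose_mul, Matrix.mul_assoc]
    have h2 : Aeᵀ * Cᵀ * C * Ae = (C * Ae)ᵀ * (C * Ae) := by
      simp only [transpose_mul, Matrix.mul_assoc]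
    rw [hXt, dotProduct_fromBlocks_mulVec, h1, h2]
    simp only [add_mulVec, smul_mulVec, dotProduct_add, dotProduct_smul,
      dotProduct_transpose_mul_self_mulVec, zero_mulVec, dotProduct_zero, smul_eq_mul]
    rw [← mulVec_mulVec _ (C * B), ← mulVec_mulVec _ C Ae, hcol (C * B)]
    ring
  have hΘ := hΘ₁.dotProduct_mulVec_nonneg (Sum.elim (X t) fun _ => z)
  rw [star_trivial, neg_mulVec, dotProduct_neg, hΘ₁def, dotProduct_lyapunov_mulVec, ← hX', hH]
    at hΘ
  rw [hV]
  simp only [hV']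
  nlinarith [mul_le_mul_of_nonneg_left hz2 hβ.le]
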